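/- Let F = ℚ(x, y) be the rational function field in two variables. There exist n ∈ ℕ, rational numbers ν_1, …, ν_n, and nonconstant rational functions g_1, …, g_n ∈ ℚ(x, y) such that S^⧢ I^+_{4,1}(x, y) − S^⧢ Ĩ^+_{4,1}(x, y) = Σ_{j=1}^n ν_j · S^⧢ Li_5(g_j) in V_F^{⊗5}. -/

import Mathlib

open scoped TensorProduct
open PiTensorProduct

attribute [local instance] Classical.propDecidable

set_option maxHeartbeats 1000000
set_option synthInstance.maxHeartbeats 400000

noncomputable section

namespace GrassPoly

variable (F : Type) [Field F]

/-- `V_F = F^× ⊗_ℤ ℚ` as a `ℚ`-vector space. -/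
abbrev VF : Type := ℚ ⊗[ℤ] (Additive Fˣ)

variable {F}

/-- The class `[a]` of a nonzero field element in `V_F` (defined to be `0` for `a = 0`). -/
def cls (a : F) : VF F :=
  if h : a = 0 then 0 else (1 : ℚ) ⊗ₜ[ℤ] (Additive.ofMul (Units.mk0 a h))

variable (F) in
/-- Tensor powers of V_F over ℚ. -/
abbrev TP (n : ℕ) : Type := ⨂[ℚ]^n (VF F)

instance instTPAddCommGroup (n : ℕ) : AddCommGroup (TP F n) :=
  Module.addCommMonoidToAddCommGroup ℚ

/-- Appending one extra tensor factor on the right. -/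
def snoc {n : ℕ} : TP F n →ₗ[ℚ] VF F →ₗ[ℚ] TP F (n + 1) :=
  PiTensorProduct.lift
    ((PiTensorProduct.tprod ℚ (s := fun _ : Fin (n + 1) => VF F)).curryRight)

/-- The factor `t_i` appearing in the recursive definition of the symbol,
as a function of `(a_{i-1}, a_i, a_{i+1})`. -/
def tCoef (p a q : F) : VF F :=
  if p = a then (if a = q then 0 else cls (q - a))
  else if a = q then - cls (p - a)
  else cls ((q - a) / (p - a))

/-- The symbol `S I(a₀; a₁, …, a_m; a_{m+1})`, with the middle entries given as a list
(of length `n`). -/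
def SIaux : (n : ℕ) → (a0 : F) → (as : List F) → (b : F) → as.length = n → TP F n
  | 0, _, _, _, _ => tprod ℚ (fun i : Fin 0 => i.elim0)
  | n + 1, a0, as, b, h =>
      ∑ i : Fin (n + 1),
        snoc (SIaux n a0 (as.eraseIdx i.val) b
            (by
              have hi' := i.isLt
              have hi : i.val < as.length := by omega
              have h2 := List.length_eraseIdx_of_lt hi
              omega))
          (tCoef ((a0 :: as).getD i.val 0) (as.getD i.val 0) ((as ++ [b]).getD (i.val + 1) 0))

/-- Cyclic rotation `b₁ ⊗ … ⊗ b_N ↦ b₂ ⊗ … ⊗ b_N ⊗ b₁` on tensor powers. -/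
def rotN (n : ℕ) : TP F n ≃ₗ[ℚ] TP F n :=
  PiTensorProduct.reindex ℚ (fun _ : Fin n => VF F) (finRotate n).symm

/-- Splitting off the last tensor factor. -/
def splitLast (n : ℕ) : TP F (n + 1) ≃ₗ[ℚ] (TP F n) ⊗[ℚ] (VF F) :=
  ((PiTensorProduct.reindex ℚ (fun _ : Fin (n + 1) => VF F)
      (finSumFinEquiv (m := n) (n := 1)).symm).trans
    (PiTensorProduct.tmulEquiv ℚ (VF F)).symm).trans
    (TensorProduct.congr (LinearEquiv.refl ℚ _)
      (PiTensorProduct.subsingletonEquiv (0 : Fin 1)))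

/-- The projector `Π̃_N` annihilating symbols of products. -/
def Pit : (n : ℕ) → TP F n →ₗ[ℚ] TP F n
  | 0 => LinearMap.id
  | 1 => LinearMap.id
  | (n + 2) =>
      ((splitLast (n + 1)).symm.toLinearMap
        ∘ₗ TensorProduct.map (Pit (n + 1)) LinearMap.id
        ∘ₗ (splitLast (n + 1)).toLinearMap)
      ∘ₗ ((LinearMap.id : TP F (n + 2) →ₗ[ℚ] TP F (n + 2)) - (rotN (F := F) (n + 2)).toLinearMap)

/-- The map on `V_F` induced by a field automorphism. -/
def vmap (φ : F ≃+* F) : VF F →ₗ[ℚ] VF F :=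
  TensorProduct.AlgebraTensorModule.map (LinearMap.id : ℚ →ₗ[ℚ] ℚ)
    (AddMonoidHom.toIntLinearMap
      { toFun := fun a => Additive.ofMul ((Units.map (φ : F →* F)) a.toMul)
        map_zero' := by simp
        map_add' := by intro a b; simp [_root_.map_mul] })

/-- The induced map on tensor powers. -/
def tpMap {n : ℕ} (φ : F ≃+* F) : TP F n →ₗ[ℚ] TP F n :=
  PiTensorProduct.map (fun _ => vmap φ)


/-! ### Symbols of (multiple) polylogarithms -/

/-- Symbol of `Li₂`. -/
def SLi2 (x : F) : TP F 2 := - SIaux 2 0 [x⁻¹, 0] 1 rfl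

/-- Symbol of `Li₃`. -/
def SLi3 (x : F) : TP F 3 := - SIaux 3 0 [x⁻¹, 0, 0] 1 rfl

/-- Symbol of `Li₄`. -/
def SLi4 (x : F) : TP F 4 := - SIaux 4 0 [x⁻¹, 0, 0, 0] 1 rfl

/-- Symbol of `Li₅`. -/
def SLi5 (x : F) : TP F 5 := - SIaux 5 0 [x⁻¹, 0, 0, 0, 0] 1 rfl

/-- Symbol of `I_{3,1}(x,y) = I(0; x,0,0,y; 1)`. -/
def SI31 (x y : F) : TP F 4 := SIaux 4 0 [x, 0, 0, y] 1 rfl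

/-- Symbol of `I_{4,1}(x,y) = I(0; x,0,0,0,y; 1)`. -/
def SI41 (x y : F) : TP F 5 := SIaux 5 0 [x, 0, 0, 0, y] 1 rfl

/-- Symbol of `I⁺_{4,1}(x,y) = ½ (I_{4,1}(x,y) + I_{4,1}(x,y⁻¹))`. -/
def I41p (x y : F) : TP F 5 := (2 : ℚ)⁻¹ • (SI41 x y + SI41 x y⁻¹)

/-- The anharmonic orbit of `x`, together with the signs of the
corresponding permutations in `S₃`. -/
def anhList (x : F) : List (ℚ × F) :=
  [(1, x), (1, (1 - x)⁻¹), (1, 1 - x⁻¹), (-1, x⁻¹), (-1, 1 - x), (-1, x / (x - 1))]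

/-- Symbol of `Ĩ_{3,1}(x,y) = (1/36) Σ_{σ,π ∈ S₃} sgn(σ) sgn(π) I_{3,1}(x^σ, y^π)`. -/
def tI31 (x y : F) : TP F 4 :=
  (36 : ℚ)⁻¹ •
    ((anhList x).map (fun p =>
      ((anhList y).map (fun q => (p.1 * q.1) • SI31 p.2 q.2)).sum)).sum

/-- Symbol of `Ĩ⁺_{4,1}(x,y) = (1/6) Σ_{σ ∈ S₃} sgn(σ) I⁺_{4,1}(x^σ, y)`. -/
def tI41p (x y : F) : TP F 5 :=
  (6 : ℚ)⁻¹ • ((anhList x).map (fun p => p.1 • I41p p.2 y)).sum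

/-- Symbol of `V(z; x, y) = Ĩ_{3,1}(z, [x]+[y]+[(1-x)/(1-xy)]+[1-xy]+[(1-y)/(1-xy)])`. -/
def Vc (z x y : F) : TP F 4 :=
  tI31 z x + tI31 z y + tI31 z ((1 - x) / (1 - x * y)) + tI31 z (1 - x * y)
    + tI31 z ((1 - y) / (1 - x * y))

/-- `Sym₃₆(a,b) := I_{3,1}(a,b) - Ĩ_{3,1}(a,b)` (on the level of symbols). -/
def S36 (a b : F) : TP F 4 := SI31 a b - tI31 a b

/-! ### Generic vectors -/

variable (N m : ℕ)

/-- Polynomial ring on the entries of `N` generic vectors in `m`-space. -/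
abbrev Pol : Type := MvPolynomial (Fin N × Fin m) ℚ

/-- The field of rational functions in the entries of `N` generic vectors in `m`-space. -/
abbrev FF : Type := FractionRing (Pol N m)

/-- The `j`-th coordinate of the `i`-th generic vector. -/
def gen (i : Fin N) (j : Fin m) : FF N m :=
  algebraMap (Pol N m) (FF N m) (MvPolynomial.X (i, j))

/-- `⟨i₁ … i_m⟩`: the determinant of the matrix whose columns are
the generic vectors selected by `cols`. -/
def dets (cols : Fin m → Fin N) : FF N m :=
  (Matrix.of fun r c => gen N m (cols c) r).det

/-- The field automorphism of `FF N m` induced by a permutation of the `N` vectors. -/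
def permAut (σ : Equiv.Perm (Fin N)) : FF N m ≃+* FF N m :=
  IsFractionRing.ringEquivOfRingEquiv
    ((MvPolynomial.renameEquiv ℚ (σ.prodCongr (Equiv.refl (Fin m)))).toRingEquiv)

variable {N m}

/-- Skew-symmetrization over all permutations of the `N` generic vectors. -/
def Alt {n : ℕ} (x : TP (FF N m) n) : TP (FF N m) n :=
  ∑ σ : Equiv.Perm (Fin N), (((Equiv.Perm.sign σ : ℤˣ) : ℤ) : ℚ) • tpMap (permAut N m σ) x

end GrassPoly

end

namespace GrassPoly

noncomputable section TwoVar

/-- The rational function field `ℚ(x, y)`. -/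
abbrev K2 : Type := FractionRing (MvPolynomial (Fin 2) ℚ)

/-- The variable `x`. -/
def xx : K2 := algebraMap (MvPolynomial (Fin 2) ℚ) K2 (MvPolynomial.X 0)

/-- The variable `y`. -/
def yy : K2 := algebraMap (MvPolynomial (Fin 2) ℚ) K2 (MvPolynomial.X 1)

end TwoVar

end GrassPoly

open GrassPoly

namespace GrassPoly

section TensorWords

variable {F : Type} [Field F]

lemma snoc_tprod {n : ℕ} (f : Fin n → VF F) (v : VF F) :
    snoc (tprod ℚ f) v = tprod ℚ (Fin.snoc f v : Fin (n + 1) → VF F) := by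
  simp [snoc, PiTensorProduct.lift.tprod, MultilinearMap.curryRight_apply]

lemma splitLast_tprod (n : ℕ) (f : Fin (n + 1) → VF F) :
    splitLast n (tprod ℚ f) = tprod ℚ (Fin.init f) ⊗ₜ[ℚ] f (Fin.last n) := by
  simp only [splitLast, LinearEquiv.trans_apply]
  erw [PiTensorProduct.reindex_tprod]
  erw [PiTensorProduct.tmulEquiv_symm_apply]
  erw [TensorProduct.congr_tmul]
  erw [PiTensorProduct.subsingletonEquiv_apply_tprod]
  rfl

lemma splitLast_snoc {n : ℕ} (t : TP F n) (v : VF F) :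
    splitLast n (snoc t v) = t ⊗ₜ[ℚ] v := by
  induction t using PiTensorProduct.induction_on with
  | smul_tprod r f =>
    rw [map_smul, LinearMap.smul_apply, map_smul, snoc_tprod, splitLast_tprod]
    simp [TensorProduct.smul_tmul']
  | add s t hs ht => rw [map_add, LinearMap.add_apply, map_add, hs, ht, TensorProduct.add_tmul]

lemma splitLast_symm_tmul {n : ℕ} (t : TP F n) (v : VF F) :
    (splitLast n).symm (t ⊗ₜ[ℚ] v) = snoc t v := by
  rw [LinearEquiv.symm_apply_eq, splitLast_snoc]

lemma rotN_tprod (n : ℕ) (f : Fin (n + 1) → VF F) :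
    rotN (n + 1) (tprod ℚ f) = tprod ℚ (Fin.snoc (Fin.tail f) (f 0) : Fin (n + 1) → VF F) := by
  simp only [rotN]
  erw [PiTensorProduct.reindex_tprod]
  congr 1
  funext i
  refine Fin.lastCases ?_ (fun j => ?_) i
  · simp
  · simp [Fin.tail]

lemma Pit_tprod (n : ℕ) (f : Fin (n + 2) → VF F) :
    Pit (n + 2) (tprod ℚ f) =
      snoc (Pit (n + 1) (tprod ℚ (Fin.init f))) (f (Fin.last (n + 1))) -
        snoc (Pit (n + 1) (tprod ℚ (Fin.tail f))) (f 0) := by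
  have h : Pit (n + 2) (tprod ℚ f) = (splitLast (n + 1)).symm
      (TensorProduct.map (Pit (n + 1)) LinearMap.id
        (splitLast (n + 1) (tprod ℚ f - rotN (n + 2) (tprod ℚ f)))) := rfl
  rw [h, rotN_tprod, map_sub, splitLast_tprod, splitLast_tprod, map_sub, map_sub,
    TensorProduct.map_tmul, TensorProduct.map_tmul, splitLast_symm_tmul, splitLast_symm_tmul]
  simp


lemma cls_mul {a b : F} (ha : a ≠ 0) (hb : b ≠ 0) : cls (a * b) = cls a + cls b := by
  rw [cls, cls, cls, dif_neg ha, dif_neg hb, dif_neg (mul_ne_zero ha hb), ← TensorProduct.tmul_add]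
  congr 1
  rw [← ofMul_mul]
  congr 1
  ext
  simp

@[simp] lemma cls_one : cls (1 : F) = 0 := by
  have h := cls_mul (one_ne_zero (α := F)) one_ne_zero
  rwa [mul_one, left_eq_add] at h

lemma cls_inv (a : F) : cls a⁻¹ = -cls a := by
  by_cases ha : a = 0
  · simp [ha, cls]
  · have h := cls_mul ha (inv_ne_zero ha)
    rw [mul_inv_cancel₀ ha, cls_one] at h
    exact eq_neg_of_add_eq_zero_right h.symm

lemma cls_div {a b : F} (ha : a ≠ 0) (hb : b ≠ 0) : cls (a / b) = cls a - cls b := by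
  rw [div_eq_mul_inv, cls_mul ha (inv_ne_zero hb), cls_inv, sub_eq_add_neg]

lemma cls_neg (a : F) : cls (-a) = cls a := by
  by_cases ha : a = 0
  · simp [ha]
  · have h1 : cls (-1 : F) + cls (-1 : F) = 0 := by
      rw [← cls_mul (by simp) (by simp)]; simp
    have h2 : cls (-1 : F) = 0 := by
      rw [← two_smul ℚ] at h1
      exact (smul_eq_zero.mp h1).resolve_left two_ne_zero
    rw [neg_eq_neg_one_mul, cls_mul (by simp) ha, h2, zero_add]

lemma cls_sub_comm (a b : F) : cls (a - b) = cls (b - a) := by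
  rw [← cls_neg, neg_sub]

lemma cls_zpow {a : F} (ha : a ≠ 0) (n : ℤ) : cls (a ^ n) = n • cls a := by
  induction n using Int.induction_on with
  | zero => simp
  | succ n ih => rw [zpow_add_one₀ ha, cls_mul (zpow_ne_zero _ ha) ha, ih, add_smul, one_smul]
  | pred n ih =>
    rw [zpow_sub_one₀ ha, cls_mul (zpow_ne_zero _ ha) (inv_ne_zero ha), ih, cls_inv, sub_smul,
      one_smul, sub_eq_add_neg]

lemma cls_prod_zpow {ι : Type*} [Fintype ι] (L : ι → F) (hL : ∀ i, L i ≠ 0) (e : ι → ℤ) :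
    cls (∏ i, L i ^ e i) = ∑ i, e i • cls (L i) := by
  have h : ∀ s : Finset ι, cls (∏ i ∈ s, L i ^ e i) = ∑ i ∈ s, e i • cls (L i) := by
    intro s
    induction s using Finset.induction_on with
    | empty => simp
    | insert i s hi ih =>
      rw [Finset.prod_insert hi, Finset.sum_insert hi, ← ih, ← cls_zpow (hL i),
        cls_mul (zpow_ne_zero _ (hL i))
          (Finset.prod_ne_zero_iff.mpr fun j _ => zpow_ne_zero _ (hL j))]
  exact h _

/-- The tensor `v₁ ⊗ … ⊗ v_n` of the entries of a list in reverse order. -/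
def revTensor : (n : ℕ) → List (VF F) → TP F n
  | 0, _ => tprod ℚ fun i : Fin 0 => i.elim0
  | _ + 1, [] => 0
  | n + 1, v :: l => snoc (revTensor n l) v

lemma SIaux_succ (n : ℕ) (a0 : F) (as : List F) (b : F) (h : as.length = n + 1) :
    SIaux (n + 1) a0 as b h = ∑ i : Fin (n + 1),
        snoc (SIaux n a0 (as.eraseIdx i.val) b (by
              have h2 := List.length_eraseIdx_of_lt (i.isLt.trans_eq h.symm)
              omega))
          (tCoef ((a0 :: as).getD i.val 0) (as.getD i.val 0) ((as ++ [b]).getD (i.val + 1) 0)) :=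
  rfl

section Depth

variable {a b : F}

lemma tCoef_zero_zero (q : F) : tCoef 0 0 q = cls q := by
  unfold tCoef
  by_cases h : (0 : F) = q <;> simp [h, cls]

lemma tCoef_right_zero (p : F) : tCoef p 0 0 = - cls p := by
  unfold tCoef
  by_cases h : p = 0 <;> simp [h, cls]

lemma tCoef_of_ne {p a q : F} (h1 : p ≠ a) (h2 : a ≠ q) :
    tCoef p a q = cls (q - a) - cls (p - a) := by
  rw [tCoef, if_neg h1, if_neg h2, cls_div (sub_ne_zero.mpr h2.symm) (sub_ne_zero.mpr h1)]

lemma tCoef_zero_ne_zero (ha : a ≠ 0) : tCoef 0 a 0 = 0 := by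
  rw [tCoef_of_ne ha.symm ha, sub_self]

lemma SIaux_zero (a0 : F) (as : List F) (b : F) (h : as.length = 0) :
    SIaux 0 a0 as b h = revTensor 0 [] := rfl

lemma revTensor_cons (n : ℕ) (v : VF F) (l : List (VF F)) :
    revTensor (n + 1) (v :: l) = snoc (revTensor n l) v := rfl

lemma SI_one (ha : a ≠ 0) (ha1 : a ≠ 1) (h : [a].length = 1) :
    SIaux 1 0 [a] 1 h = revTensor 1 [cls (1 - a) - cls a] := by
  simp [SIaux_succ, SIaux_zero, revTensor_cons, tCoef_of_ne ha.symm ha1, cls_neg]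

lemma SI_two (ha : a ≠ 0) (ha1 : a ≠ 1) (h : [a, 0].length = 2) :
    SIaux 2 0 [a, 0] 1 h = revTensor 2 [-cls a, cls (1 - a) - cls a] := by
  rw [SIaux_succ, revTensor_cons, ← SI_one ha ha1 rfl]
  simp [Fin.sum_univ_succ, tCoef_of_ne ha (zero_ne_one' F), tCoef_zero_ne_zero ha]

lemma SI_three (ha : a ≠ 0) (ha1 : a ≠ 1) (h : [a, 0, 0].length = 3) :
    SIaux 3 0 [a, 0, 0] 1 h = revTensor 3 [-cls a, -cls a, cls (1 - a) - cls a] := by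
  rw [SIaux_succ, revTensor_cons, ← SI_two ha ha1 rfl]
  simp [Fin.sum_univ_succ, tCoef_zero_zero, tCoef_right_zero, tCoef_zero_ne_zero ha]

lemma SI_four (ha : a ≠ 0) (ha1 : a ≠ 1) (h : [a, 0, 0, 0].length = 4) :
    SIaux 4 0 [a, 0, 0, 0] 1 h = revTensor 4 [-cls a, -cls a, -cls a, cls (1 - a) - cls a] := by
  rw [SIaux_succ, revTensor_cons, ← SI_three ha ha1 rfl]
  have h0 : cls (0 : F) = 0 := dif_pos rfl
  simp [Fin.sum_univ_succ, tCoef_zero_zero, tCoef_right_zero, tCoef_zero_ne_zero ha, h0]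

lemma SI_five (ha : a ≠ 0) (ha1 : a ≠ 1) (h : [a, 0, 0, 0, 0].length = 5) :
    SIaux 5 0 [a, 0, 0, 0, 0] 1 h =
      revTensor 5 [-cls a, -cls a, -cls a, -cls a, cls (1 - a) - cls a] := by
  rw [SIaux_succ, revTensor_cons, ← SI_four ha ha1 rfl]
  have h0 : cls (0 : F) = 0 := dif_pos rfl
  simp [Fin.sum_univ_succ, tCoef_zero_zero, tCoef_right_zero, tCoef_zero_ne_zero ha, h0]

lemma SLi5_eq {g : F} (hg : g ≠ 0) (hg1 : g ≠ 1) :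
    SLi5 g = -revTensor 5 [cls g, cls g, cls g, cls g, cls (1 - g)] := by
  have h : cls (1 - g⁻¹) - cls g⁻¹ = cls (1 - g) := by
    rw [show 1 - g⁻¹ = -((1 - g) / g) by field_simp; ring, cls_neg,
      cls_div (sub_ne_zero.mpr hg1.symm) hg, cls_inv]
    abel
  rw [SLi5, SI_five (inv_ne_zero hg) (by simpa using hg1), h, cls_inv, neg_neg]

lemma SI_pair (ha : a ≠ 0) (ha1 : a ≠ 1) (hb : b ≠ 0) (hb1 : b ≠ 1) (hab : a ≠ b)
    (h : [a, b].length = 2) :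
    SIaux 2 0 [a, b] 1 h = revTensor 2 [cls (a - b) - cls a, cls (1 - b) - cls b] +
      revTensor 2 [cls (1 - b) - cls (a - b), cls (1 - a) - cls a] := by
  rw [SIaux_succ, revTensor_cons 1 (cls (a - b) - cls a),
    revTensor_cons 1 (cls (1 - b) - cls (a - b)), ← SI_one ha ha1 rfl, ← SI_one hb hb1 rfl]
  simp [Fin.sum_univ_succ, tCoef_of_ne ha.symm hab, tCoef_of_ne hab hb1, cls_neg,
    cls_sub_comm b a]

lemma SI11_step (ha : a ≠ 0) (ha1 : a ≠ 1) (hb : b ≠ 0) (hb1 : b ≠ 1) (h : [a, 0, b].length = 3) :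
    SIaux 3 0 [a, 0, b] 1 h = snoc (SIaux 2 0 [a, b] 1 rfl) (cls b - cls a) +
      revTensor 3 [cls (1 - b) - cls b, -cls a, cls (1 - a) - cls a] := by
  rw [SIaux_succ, revTensor_cons, ← SI_two ha ha1 rfl]
  simp [Fin.sum_univ_succ, tCoef_of_ne ha hb.symm, tCoef_of_ne hb.symm hb1, cls_neg,
    tCoef_zero_ne_zero ha]

lemma SI21_step (ha : a ≠ 0) (ha1 : a ≠ 1) (hb : b ≠ 0) (hb1 : b ≠ 1)
    (h : [a, 0, 0, b].length = 4) :
    SIaux 4 0 [a, 0, 0, b] 1 h = snoc (SIaux 3 0 [a, 0, b] 1 rfl) (cls b - cls a) +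
      revTensor 4 [cls (1 - b) - cls b, -cls a, -cls a, cls (1 - a) - cls a] := by
  rw [SIaux_succ, revTensor_cons, ← SI_three ha ha1 rfl]
  simp [Fin.sum_univ_succ, tCoef_zero_zero, tCoef_right_zero, tCoef_of_ne hb.symm hb1, cls_neg,
    tCoef_zero_ne_zero ha]
  abel

lemma SI41_step (ha : a ≠ 0) (ha1 : a ≠ 1) (hb : b ≠ 0) (hb1 : b ≠ 1) :
    SI41 a b = snoc (SIaux 4 0 [a, 0, 0, b] 1 rfl) (cls b - cls a) +
      revTensor 5 [cls (1 - b) - cls b, -cls a, -cls a, -cls a, cls (1 - a) - cls a] := by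
  rw [SI41, SIaux_succ, revTensor_cons, ← SI_four ha ha1 rfl]
  have h0 : cls (0 : F) = 0 := dif_pos rfl
  simp [Fin.sum_univ_succ, tCoef_zero_zero, tCoef_right_zero, tCoef_of_ne hb.symm hb1, cls_neg,
    tCoef_zero_ne_zero ha, h0]
  abel

lemma SI41_eq (ha : a ≠ 0) (ha1 : a ≠ 1) (hb : b ≠ 0) (hb1 : b ≠ 1) (hab : a ≠ b) :
    SI41 a b =
      revTensor 5 [cls b - cls a, cls b - cls a, cls b - cls a, cls (a - b) - cls a,
        cls (1 - b) - cls b] +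
      revTensor 5 [cls b - cls a, cls b - cls a, cls b - cls a, cls (1 - b) - cls (a - b),
        cls (1 - a) - cls a] +
      revTensor 5 [cls b - cls a, cls b - cls a, cls (1 - b) - cls b, -cls a,
        cls (1 - a) - cls a] +
      revTensor 5 [cls b - cls a, cls (1 - b) - cls b, -cls a, -cls a, cls (1 - a) - cls a] +
      revTensor 5 [cls (1 - b) - cls b, -cls a, -cls a, -cls a, cls (1 - a) - cls a] := by
  rw [SI41_step ha ha1 hb hb1, SI21_step ha ha1 hb hb1, SI11_step ha ha1 hb hb1,
    SI_pair ha ha1 hb hb1 hab]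
  simp only [map_add, LinearMap.add_apply, ← revTensor_cons]

end Depth

section Words

variable {m : ℕ} (L : Fin m → VF F)

/-- The element of `V_F` with integral coordinates `e` in the letters `L`. -/
def letterSum : (Fin m → ℤ) →ₗ[ℤ] VF F := Fintype.linearCombination ℤ L

/-- The value of a formal combination of elementary tensors whose factors are given by their
coordinates in the letters `L`; factors are listed from last to first. -/
def evalTerms (n : ℕ) (ts : List (ℤ × List (Fin m → ℤ))) : TP F n :=
  (ts.map fun t => t.1 • revTensor n (t.2.map (letterSum L))).sum

/-- Multiplication of a formal combination by an integer and by a new last tensor factor. -/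
def consTerms (c : ℤ) (v : Fin m → ℤ) (ts : List (ℤ × List (Fin m → ℤ))) :
    List (ℤ × List (Fin m → ℤ)) :=
  ts.map fun t => (c * t.1, v :: t.2)

/-- Multiplication of a formal combination by an integer. -/
def scaleTerms (c : ℤ) (ts : List (ℤ × List (Fin m → ℤ))) : List (ℤ × List (Fin m → ℤ)) :=
  ts.map fun t => (c * t.1, t.2)

@[simp] lemma evalTerms_nil (n : ℕ) : evalTerms L n [] = 0 := rfl

lemma evalTerms_cons (n : ℕ) (t : ℤ × List (Fin m → ℤ)) (ts : List (ℤ × List (Fin m → ℤ))) :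
    evalTerms L n (t :: ts) =
      t.1 • revTensor n (t.2.map (letterSum L)) + evalTerms L n ts := by
  simp [evalTerms]

lemma evalTerms_append (n : ℕ) (s t : List (ℤ × List (Fin m → ℤ))) :
    evalTerms L n (s ++ t) = evalTerms L n s + evalTerms L n t := by
  simp [evalTerms]

lemma evalTerms_scaleTerms (n : ℕ) (c : ℤ) (ts : List (ℤ × List (Fin m → ℤ))) :
    evalTerms L n (scaleTerms c ts) = c • evalTerms L n ts := by
  induction ts with
  | nil => simp [scaleTerms]
  | cons t ts ih =>
    rw [evalTerms_cons, smul_add, ← ih, smul_smul]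
    exact evalTerms_cons ..

lemma evalTerms_consTerms (n : ℕ) (c : ℤ) (v : Fin m → ℤ) (ts : List (ℤ × List (Fin m → ℤ))) :
    evalTerms L (n + 1) (consTerms c v ts) = c • snoc (evalTerms L n ts) (letterSum L v) := by
  induction ts with
  | nil => simp [consTerms]
  | cons t ts ih =>
    rw [evalTerms_cons, map_add, LinearMap.add_apply, smul_add, ← ih, map_zsmul,
      LinearMap.smul_apply, smul_smul, ← revTensor_cons]
    exact evalTerms_cons ..

/-- The terms of a formal combination whose last factor involves the letter `i`, with that
factor removed. -/
def peel (i : Fin m) (ts : List (ℤ × List (Fin m → ℤ))) : List (ℤ × List (Fin m → ℤ)) :=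
  ts.filterMap fun t =>
    match t.2 with
    | [] => none
    | v :: l =>
      match v i with
      | .ofNat 0 => none
      | c => some (t.1 * c, l)

/-- A test for the vanishing of a formal combination in the free tensor power. -/
def isZero : ℕ → List (ℤ × List (Fin m → ℤ)) → Bool
  | _, [] => true
  | 0, ts =>
    match ts.foldr (fun t s => t.1 + s) 0 with
    | .ofNat 0 => true
    | _ => false
  | n + 1, ts => (List.finRange m).all fun i => isZero n (peel i ts)

lemma evalTerms_peel_cons (n : ℕ) (i : Fin m) (c : ℤ) (v : Fin m → ℤ) (l : List (Fin m → ℤ))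
    (ts : List (ℤ × List (Fin m → ℤ))) :
    evalTerms L n (peel i ((c, v :: l) :: ts)) =
      (c * v i) • revTensor n (l.map (letterSum L)) + evalTerms L n (peel i ts) := by
  by_cases h : v i = 0
  · have : peel i ((c, v :: l) :: ts) = peel i ts := by
      simp only [peel]
      rw [List.filterMap_cons_none]
      simp only [h]
      rfl
    rw [this, h, mul_zero, zero_smul, zero_add]
  · have : peel i ((c, v :: l) :: ts) = (c * v i, l) :: peel i ts := by
      simp only [peel]
      rw [List.filterMap_cons_some]
      dsimp only
      split
      · next h' => exact absurd h' h
      · rfl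
    rw [this, evalTerms_cons]

lemma evalTerms_succ (n : ℕ) (ts : List (ℤ × List (Fin m → ℤ))) :
    evalTerms L (n + 1) ts = ∑ i, snoc (evalTerms L n (peel i ts)) (L i) := by
  induction ts with
  | nil => simp [peel]
  | cons t ts ih =>
    obtain ⟨c, _ | ⟨v, l⟩⟩ := t
    · have h (i : Fin m) : peel i ((c, []) :: ts) = peel i ts := rfl
      simp only [h]
      rw [evalTerms_cons, ih]
      simp [revTensor]
    · simp only [evalTerms_peel_cons, map_add, LinearMap.add_apply, Finset.sum_add_distrib]
      rw [evalTerms_cons, ih, List.map_cons, revTensor_cons, letterSum,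
        Fintype.linearCombination_apply, map_sum, Finset.smul_sum]
      congr 1
      refine Finset.sum_congr rfl fun i _ => ?_
      rw [map_zsmul, map_zsmul, LinearMap.smul_apply, smul_smul]

theorem evalTerms_eq_zero {n : ℕ} {ts : List (ℤ × List (Fin m → ℤ))} (h : isZero n ts = true) :
    evalTerms L n ts = 0 := by
  induction n generalizing ts with
  | zero =>
    have key : ∀ us : List (ℤ × List (Fin m → ℤ)),
        evalTerms L 0 us = us.foldr (fun t s => t.1 + s) 0 • revTensor (F := F) 0 [] := by
      intro us
      induction us with
      | nil => simp
      | cons t us ih => rw [evalTerms_cons, ih, List.foldr_cons, add_smul]; rfl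
    rw [key]
    cases ts with
    | nil => simp
    | cons t ts =>
      rw [isZero] at h
      · split at h
        · next h' =>
          rw [h']
          exact zero_smul _ _
        · simp at h
      · simp
  | succ n ih =>
    cases ts with
    | nil => simp
    | cons t ts =>
      rw [isZero, List.all_eq_true] at h
      · rw [evalTerms_succ]
        exact Finset.sum_eq_zero fun i _ => by rw [ih (h i (List.mem_finRange i))]; simp
      · simp

/-- The projector `Π̃_n` on an elementary tensor. -/
def pitTerms : (n : ℕ) → (Fin n → Fin m → ℤ) → List (ℤ × List (Fin m → ℤ))
  | 0, _ => [(1, [])]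
  | 1, f => [(1, [f 0])]
  | n + 2, f => consTerms 1 (f (Fin.last (n + 1))) (pitTerms (n + 1) (Fin.init f)) ++
      consTerms (-1) (f 0) (pitTerms (n + 1) (Fin.tail f))

lemma evalTerms_pitTerms (n : ℕ) (f : Fin n → Fin m → ℤ) :
    evalTerms L n (pitTerms n f) = Pit n (tprod ℚ fun i => letterSum L (f i)) := by
  induction n using Nat.twoStepInduction with
  | zero =>
    rw [pitTerms, evalTerms_cons, evalTerms_nil, one_smul, add_zero]
    simp only [Pit, LinearMap.id_apply, revTensor]
    congr 1
    exact Subsingleton.elim _ _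
  | one =>
    rw [pitTerms, evalTerms_cons, evalTerms_nil, one_smul, add_zero]
    simp only [Pit, LinearMap.id_apply, List.map_cons, revTensor, snoc_tprod]
    congr 1
    funext i
    fin_cases i
    rfl
  | more n _ ih =>
    rw [pitTerms, evalTerms_append, evalTerms_consTerms, evalTerms_consTerms, ih, ih, Pit_tprod,
      one_smul, neg_one_smul, ← sub_eq_add_neg]
    rfl

lemma revTensor_five (v₁ v₂ v₃ v₄ v₅ : VF F) :
    revTensor 5 [v₅, v₄, v₃, v₂, v₁] = tprod ℚ ![v₁, v₂, v₃, v₄, v₅] := by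
  simp only [revTensor, snoc_tprod]
  congr 1
  funext i
  fin_cases i <;> rfl

lemma evalTerms_pitTerms_five (v₁ v₂ v₃ v₄ v₅ : Fin m → ℤ) :
    evalTerms L 5 (pitTerms 5 ![v₁, v₂, v₃, v₄, v₅]) =
      Pit 5 (revTensor 5 [letterSum L v₅, letterSum L v₄, letterSum L v₃, letterSum L v₂,
        letterSum L v₁]) := by
  rw [evalTerms_pitTerms, revTensor_five]
  congr 2
  funext i
  fin_cases i <;> rfl

lemma Pit_tprod_const (n : ℕ) (v : VF F) : Pit (n + 2) (tprod ℚ fun _ => v) = 0 := by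
  rw [Pit_tprod]
  exact sub_self _

lemma Pit_tprod_cons_const (n : ℕ) (u v : VF F) :
    Pit (n + 3) (tprod ℚ (Fin.cons u fun _ => v : Fin (n + 3) → VF F)) =
      snoc (Pit (n + 2) (tprod ℚ (Fin.cons u fun _ => v : Fin (n + 2) → VF F))) v := by
  rw [Pit_tprod, Fin.tail_cons, Pit_tprod_const, map_zero, LinearMap.zero_apply, sub_zero]
  congr 4
  funext i
  refine Fin.cases rfl (fun j => ?_) i
  rfl

/-- The mod-products symbol of `-Li₅(g)`, where `g` and `1 - g` have coordinates `e` and `f`. -/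
def liTerms (e f : Fin m → ℤ) : List (ℤ × List (Fin m → ℤ)) :=
  consTerms 1 e (consTerms 1 e (consTerms 1 e (pitTerms 2 (Fin.cons f fun _ => e))))

lemma Pit_SLi5 {g : F} (hg : g ≠ 0) (hg1 : g ≠ 1) {e f : Fin m → ℤ}
    (he : cls g = letterSum L e) (hf : cls (1 - g) = letterSum L f) :
    Pit 5 (SLi5 g) = -evalTerms L 5 (liTerms e f) := by
  have h2 : (fun i => letterSum L ((Fin.cons f fun _ => e : Fin 2 → Fin m → ℤ) i)) =
      (Fin.cons (cls (1 - g)) fun _ => cls g : Fin 2 → VF F) := by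
    funext i
    fin_cases i
    · exact hf.symm
    · exact he.symm
  have h5 : (![cls (1 - g), cls g, cls g, cls g, cls g] : Fin 5 → VF F) =
      Fin.cons (cls (1 - g)) fun _ => cls g := by
    funext i
    fin_cases i <;> rfl
  rw [SLi5_eq hg hg1, map_neg, revTensor_five, h5, Pit_tprod_cons_const 2,
    Pit_tprod_cons_const 1, Pit_tprod_cons_const 0, liTerms]
  simp only [evalTerms_consTerms, one_smul, evalTerms_pitTerms, h2, ← he]

/-- The mod-products symbol of `I_{4,1}(a, b)`, where `a`, `1 - a`, `b`, `1 - b` and `a - b` have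
coordinates `A`, `A'`, `B`, `B'` and `D`. -/
def siTerms (A A' B B' D : Fin m → ℤ) : List (ℤ × List (Fin m → ℤ)) :=
  pitTerms 5 ![B' - B, D - A, B - A, B - A, B - A] ++
  pitTerms 5 ![A' - A, B' - D, B - A, B - A, B - A] ++
  pitTerms 5 ![A' - A, -A, B' - B, B - A, B - A] ++
  pitTerms 5 ![A' - A, -A, -A, B' - B, B - A] ++
  pitTerms 5 ![A' - A, -A, -A, -A, B' - B]

lemma Pit_SI41 {a b : F} (ha : a ≠ 0) (ha1 : a ≠ 1) (hb : b ≠ 0) (hb1 : b ≠ 1) (hab : a ≠ b)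
    {A A' B B' D : Fin m → ℤ} (hA : cls a = letterSum L A) (hA' : cls (1 - a) = letterSum L A')
    (hB : cls b = letterSum L B) (hB' : cls (1 - b) = letterSum L B')
    (hD : cls (a - b) = letterSum L D) :
    Pit 5 (SI41 a b) = evalTerms L 5 (siTerms A A' B B' D) := by
  simp only [SI41_eq ha ha1 hb hb1 hab, siTerms, evalTerms_append, evalTerms_pitTerms_five,
    map_add, map_sub, map_neg, hA, hA', hB, hB', hD]

end Words

section Tables

/-- A rational multiple of a term `Li₅(g)`, where `g` is a signed monomial in given letters and
`1 - g` is, up to sign, a monomial in these letters as well. -/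
structure LiTerm (m : ℕ) where
  /-- twelve times the coefficient of the term -/
  coeff : ℤ
  /-- the sign of `g` -/
  sign : ℤˣ
  /-- the exponents of `g` -/
  exps : Fin m → ℤ
  /-- the exponents of `1 - g` -/
  compl : Fin m → ℤ

/-- The signed monomial `g` described by a `LiTerm`. -/
def LiTerm.arg {m : ℕ} (t : LiTerm m) (l : Fin m → F) : F :=
  ((t.sign : ℤ) : F) * ∏ i, l i ^ t.exps i

lemma LiTerm.cls_arg {m : ℕ} (t : LiTerm m) {l : Fin m → F} (hl : ∀ i, l i ≠ 0) :
    cls (t.arg l) = letterSum (fun i => cls (l i)) t.exps := by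
  rw [letterSum, Fintype.linearCombination_apply, ← cls_prod_zpow l hl, LiTerm.arg]
  obtain h | h := Int.units_eq_one_or t.sign <;> simp [h, cls_neg]

/-- A test for the vanishing of the sum of a formal combination of elementary tensors and the
mod-products symbols of the terms `-Li₅(g)` of a table. -/
def cancels {m : ℕ} (ts : List (ℤ × List (Fin m → ℤ))) (table : List (LiTerm m)) : Bool :=
  isZero 5 (ts ++ table.flatMap fun t => scaleTerms t.coeff (liTerms t.exps t.compl))

lemma eq_sum_of_cancels {m : ℕ} {l : Fin m → F} (hl : ∀ i, l i ≠ 0)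
    {ts : List (ℤ × List (Fin m → ℤ))} {table : List (LiTerm m)}
    (h0 : ∀ t ∈ table, t.arg l ≠ 0) (h1 : ∀ t ∈ table, t.arg l ≠ 1)
    (hc : ∀ t ∈ table, 1 - t.arg l = ∏ i, l i ^ t.compl i ∨ 1 - t.arg l = -∏ i, l i ^ t.compl i)
    (h : cancels ts table = true) :
    evalTerms (fun i => cls (l i)) 5 ts =
      (table.map fun t => t.coeff • Pit 5 (SLi5 (t.arg l))).sum := by
  have key := evalTerms_eq_zero (fun i => cls (l i)) h
  rw [evalTerms_append, add_eq_zero_iff_eq_neg] at key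
  rw [key]
  clear key h
  induction table with
  | nil => simp
  | cons t table ih =>
    have hcls : cls (1 - t.arg l) = letterSum (fun i => cls (l i)) t.compl := by
      rw [letterSum, Fintype.linearCombination_apply, ← cls_prod_zpow l hl]
      obtain h | h := hc t (by simp) <;> rw [h]
      rw [cls_neg]
    rw [List.flatMap_cons, evalTerms_append, neg_add, evalTerms_scaleTerms, List.map_cons,
      List.sum_cons, Pit_SLi5 _ (h0 t (by simp)) (h1 t (by simp)) (t.cls_arg hl) hcls, smul_neg,
      ih (fun s hs => h0 s (by simp [hs])) (fun s hs => h1 s (by simp [hs]))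
        (fun s hs => hc s (by simp [hs]))]

/-- The factors occurring in the differences of the arguments of `I_{4,1}` at
`(a, b)`, `(a⁻¹, b)`, `(1 - a, b)` and their images under `b ↦ b⁻¹`. -/
def letters {R : Type} [Ring R] (a b : R) : Fin 8 → R :=
  ![a, 1 - a, b, 1 - b, a - b, 1 - a * b, 1 - a - b, 1 - b + a * b]

/-- The arguments of the `Li₅`-terms in the relation between `I⁺_{4,1}(a, b)` and
`I⁺_{4,1}(a⁻¹, b)`. -/
def inversionTable : List (LiTerm 8) := [
  ⟨-12, 1, ![-1, 0, 0, 0, 0, 0, 0, 0], ![-1, 1, 0, 0, 0, 0, 0, 0]⟩,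
  ⟨-24, 1, ![-1, 0, 1, 0, 0, 0, 0, 0], ![-1, 0, 0, 0, 1, 0, 0, 0]⟩,
  ⟨-24, 1, ![-1, 0, -1, 0, 0, 0, 0, 0], ![-1, 0, -1, 0, 0, 1, 0, 0]⟩,
  ⟨-12, 1, ![0, 0, -1, 0, 0, 0, 0, 0], ![0, 0, -1, 1, 0, 0, 0, 0]⟩]

/-- The arguments of the `Li₅`-terms in the relation between `I⁺_{4,1}(a, b)` and
`I⁺_{4,1}(1 - a, b)`. -/
def reflectionTable : List (LiTerm 8) := [
  ⟨6, 1, ![-1, 0, 0, 0, 0, 0, 0, 0], ![-1, 1, 0, 0, 0, 0, 0, 0]⟩,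
  ⟨-6, -1, ![-1, 1, 0, 1, 0, 0, 0, 0], ![-1, 0, 0, 0, 0, 0, 0, 1]⟩,
  ⟨12, -1, ![-1, 1, 0, 0, 0, 0, 0, 0], ![-1, 0, 0, 0, 0, 0, 0, 0]⟩,
  ⟨-6, 1, ![-1, 1, -1, 1, 0, 0, 0, 0], ![-1, 0, -1, 0, 0, 0, 1, 0]⟩,
  ⟨1, 1, ![-1, 2, 1, -2, 0, 0, 0, 0], ![-1, 0, 0, -2, 1, 1, 0, 0]⟩,
  ⟨1, 1, ![-2, 1, -1, 2, 0, 0, 0, 0], ![-2, 0, -1, 0, 0, 0, 1, 1]⟩,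
  ⟨-6, 1, ![-1, 1, 1, -1, 0, 0, 0, 0], ![-1, 0, 0, -1, 1, 0, 0, 0]⟩,
  ⟨-6, -1, ![-1, 1, 0, -1, 0, 0, 0, 0], ![-1, 0, 0, -1, 0, 1, 0, 0]⟩,
  ⟨6, 1, ![0, -1, 0, 0, 0, 0, 0, 0], ![1, -1, 0, 0, 0, 0, 0, 0]⟩,
  ⟨-21, 1, ![-1, 0, 1, 0, 0, 0, 0, 0], ![-1, 0, 0, 0, 1, 0, 0, 0]⟩,
  ⟨2, 1, ![-1, -1, 1, 1, 0, 0, 0, 0], ![-1, -1, 0, 0, 1, 0, 1, 0]⟩,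
  ⟨-12, 1, ![-1, 0, 0, 1, 0, 0, 0, 0], ![-1, 0, 0, 0, 0, 0, 1, 0]⟩,
  ⟨2, -1, ![-1, -1, -2, 1, 0, 0, 0, 0], ![-1, -1, -2, 0, 0, 1, 0, 1]⟩,
  ⟨-12, -1, ![-1, 0, -1, 1, 0, 0, 0, 0], ![-1, 0, -1, 0, 0, 0, 0, 1]⟩,
  ⟨-21, 1, ![-1, 0, -1, 0, 0, 0, 0, 0], ![-1, 0, -1, 0, 0, 1, 0, 0]⟩,
  ⟨-21, 1, ![0, -1, 1, 0, 0, 0, 0, 0], ![0, -1, 0, 0, 0, 0, 1, 0]⟩,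
  ⟨-12, 1, ![0, -1, 0, 1, 0, 0, 0, 0], ![0, -1, 0, 0, 1, 0, 0, 0]⟩,
  ⟨-12, -1, ![0, -1, -1, 1, 0, 0, 0, 0], ![0, -1, -1, 0, 0, 1, 0, 0]⟩,
  ⟨-21, 1, ![0, -1, -1, 0, 0, 0, 0, 0], ![0, -1, -1, 0, 0, 0, 0, 1]⟩,
  ⟨12, -1, ![0, 0, -1, 1, 0, 0, 0, 0], ![0, 0, -1, 0, 0, 0, 0, 0]⟩,
  ⟨12, 1, ![0, 0, 0, -1, 0, 0, 0, 0], ![0, 0, 1, -1, 0, 0, 0, 0]⟩]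

lemma one_sub_arg_letters {a b : F} (hl : ∀ i, letters a b i ≠ 0) :
    ∀ t ∈ inversionTable ++ reflectionTable,
      1 - t.arg (letters a b) = ∏ i, letters a b i ^ t.compl i ∨
        1 - t.arg (letters a b) = -∏ i, letters a b i ^ t.compl i := by
  have h0 := hl 0
  have h1 := hl 1
  have h2 := hl 2
  have h3 := hl 3
  have h4 := hl 4
  have h5 := hl 5
  have h6 := hl 6
  have h7 := hl 7
  simp only [letters, Matrix.cons_val] at h0 h1 h2 h3 h4 h5 h6 h7
  simp only [inversionTable, reflectionTable, List.cons_append, List.nil_append,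
    List.forall_mem_cons, List.not_mem_nil, IsEmpty.forall_iff, implies_true, and_true,
    LiTerm.arg, letters, Fin.prod_univ_eight, Matrix.cons_val, zpow_zero, zpow_one, zpow_neg,
    mul_one, one_mul, Units.val_neg, Units.val_one, Int.cast_neg, Int.cast_one]
  repeat' apply And.intro
  all_goals first
    | (left; field_simp <;> ring1)
    | (right; field_simp <;> ring1)

/-- The mod-products symbol of `6 (I_{4,1}(a, b) + I_{4,1}(a, b⁻¹))` in the letters attached to
`(x, y)`, where `b = y` and `a`, `1 - a`, `a - b` and `a - b⁻¹` have coordinates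
`A`, `A'`, `D` and `E`. -/
def siPlusTerms (A A' D E : Fin 8 → ℤ) : List (ℤ × List (Fin 8 → ℤ)) :=
  scaleTerms 6 (siTerms A A' ![0, 0, 1, 0, 0, 0, 0, 0] ![0, 0, 0, 1, 0, 0, 0, 0] D ++
    siTerms A A' ![0, 0, -1, 0, 0, 0, 0, 0] ![0, 0, -1, 1, 0, 0, 0, 0] E)

/-- `siPlusTerms` for `a = x`. -/
def baseTerms : List (ℤ × List (Fin 8 → ℤ)) :=
  siPlusTerms ![1, 0, 0, 0, 0, 0, 0, 0] ![0, 1, 0, 0, 0, 0, 0, 0]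
    ![0, 0, 0, 0, 1, 0, 0, 0] ![0, 0, -1, 0, 0, 1, 0, 0]

/-- `siPlusTerms` for `a = x⁻¹`. -/
def inversionTerms : List (ℤ × List (Fin 8 → ℤ)) :=
  siPlusTerms ![-1, 0, 0, 0, 0, 0, 0, 0] ![-1, 1, 0, 0, 0, 0, 0, 0]
    ![-1, 0, 0, 0, 0, 1, 0, 0] ![-1, 0, -1, 0, 1, 0, 0, 0]

/-- `siPlusTerms` for `a = 1 - x`. -/
def reflectionTerms : List (ℤ × List (Fin 8 → ℤ)) :=
  siPlusTerms ![0, 1, 0, 0, 0, 0, 0, 0] ![1, 0, 0, 0, 0, 0, 0, 0]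
    ![0, 0, 0, 0, 0, 0, 1, 0] ![0, 0, -1, 0, 0, 0, 0, 1]

lemma inversion_cancels : cancels (baseTerms ++ inversionTerms) inversionTable = true := by
  decide +kernel

lemma reflection_cancels : cancels (baseTerms ++ reflectionTerms) reflectionTable = true := by
  decide +kernel

/-- The letter sums of the classes of `letters a b`. -/
lemma letterSum_letters (a b : F) (e : Fin 8 → ℤ) :
    letterSum (fun i => cls (letters a b i)) e =
      e 0 • cls a + e 1 • cls (1 - a) + e 2 • cls b + e 3 • cls (1 - b) + e 4 • cls (a - b) +
        e 5 • cls (1 - a * b) + e 6 • cls (1 - a - b) + e 7 • cls (1 - b + a * b) := by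
  rw [letterSum, Fintype.linearCombination_apply, Fin.sum_univ_eight]
  rfl

lemma Pit_I41p {x y a : F} (hl : ∀ i, letters x y i ≠ 0) (ha : a ≠ 0) (ha1 : a ≠ 1) (hab : a ≠ y)
    (hab' : a ≠ y⁻¹) {A A' D E : Fin 8 → ℤ}
    (hA : cls a = letterSum (fun i => cls (letters x y i)) A)
    (hA' : cls (1 - a) = letterSum (fun i => cls (letters x y i)) A')
    (hD : cls (a - y) = letterSum (fun i => cls (letters x y i)) D)
    (hE : cls (a - y⁻¹) = letterSum (fun i => cls (letters x y i)) E) :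
    (12 : ℚ) • Pit 5 (I41p a y) =
      evalTerms (fun i => cls (letters x y i)) 5 (siPlusTerms A A' D E) := by
  have hy : y ≠ 0 := hl 2
  have hy1 : 1 - y ≠ 0 := hl 3
  have hy1' : y ≠ 1 := (sub_ne_zero.mp hy1).symm
  have hinv : cls (1 - y⁻¹) = cls (1 - y) - cls y := by
    rw [← cls_div hy1 hy, ← cls_neg]
    congr 1
    field_simp
    ring
  rw [siPlusTerms, evalTerms_scaleTerms, evalTerms_append,
    ← Pit_SI41 _ ha ha1 hy hy1' hab hA hA' (by simp [letterSum_letters])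
      (by simp [letterSum_letters]) hD,
    ← Pit_SI41 _ ha ha1 (inv_ne_zero hy) (by simpa using hy1') hab' hA hA'
      (by simp [letterSum_letters, cls_inv])
      (by simp [letterSum_letters, hinv, neg_add_eq_sub]) hE,
    I41p, map_smul, map_add, smul_smul, ← Int.cast_smul_eq_zsmul ℚ]
  norm_num

end Tables

section Relations

variable {x y : F}

lemma Pit_I41p_base (hl : ∀ i, letters x y i ≠ 0) :
    (12 : ℚ) • Pit 5 (I41p x y) = evalTerms (fun i => cls (letters x y i)) 5 baseTerms := by
  have hx : x ≠ 0 := hl 0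
  have hx1 : 1 - x ≠ 0 := hl 1
  have hy : y ≠ 0 := hl 2
  have hxy : x - y ≠ 0 := hl 4
  have hxy1 : 1 - x * y ≠ 0 := hl 5
  have hE : x - y⁻¹ = -((1 - x * y) / y) := by field_simp; ring
  have hE' : x - y⁻¹ ≠ 0 := by rw [hE]; exact neg_ne_zero.mpr (div_ne_zero hxy1 hy)
  apply Pit_I41p hl hx (sub_ne_zero.mp hx1).symm (sub_ne_zero.mp hxy) (sub_ne_zero.mp hE')
  · simp [letterSum_letters]
  · simp [letterSum_letters]
  · simp [letterSum_letters]
  · simp [letterSum_letters, hE, cls_neg, cls_div hxy1 hy, neg_add_eq_sub]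

lemma Pit_I41p_inv (hl : ∀ i, letters x y i ≠ 0) :
    (12 : ℚ) • Pit 5 (I41p x⁻¹ y) =
      evalTerms (fun i => cls (letters x y i)) 5 inversionTerms := by
  have hx : x ≠ 0 := hl 0
  have hx1 : 1 - x ≠ 0 := hl 1
  have hy : y ≠ 0 := hl 2
  have hxy : x - y ≠ 0 := hl 4
  have hxy1 : 1 - x * y ≠ 0 := hl 5
  have hA : 1 - x⁻¹ = -((1 - x) / x) := by field_simp; ring
  have hD : x⁻¹ - y = (1 - x * y) / x := by field_simp
  have hE : x⁻¹ - y⁻¹ = -((x - y) / (x * y)) := by field_simp; ring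
  have hA' : 1 - x⁻¹ ≠ 0 := by rw [hA]; exact neg_ne_zero.mpr (div_ne_zero hx1 hx)
  have hD' : x⁻¹ - y ≠ 0 := by rw [hD]; exact div_ne_zero hxy1 hx
  have hE' : x⁻¹ - y⁻¹ ≠ 0 := by
    rw [hE]; exact neg_ne_zero.mpr (div_ne_zero hxy (mul_ne_zero hx hy))
  apply Pit_I41p hl (inv_ne_zero hx) (sub_ne_zero.mp hA').symm (sub_ne_zero.mp hD')
    (sub_ne_zero.mp hE')
  · simp [letterSum_letters, cls_inv]
  · simp [letterSum_letters, hA, cls_neg, cls_div hx1 hx, neg_add_eq_sub]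
  · simp [letterSum_letters, hD, cls_div hxy1 hx, neg_add_eq_sub]
  · simp [letterSum_letters, hE, cls_neg, cls_div hxy (mul_ne_zero hx hy), cls_mul hx hy]
    abel

lemma Pit_I41p_one_sub (hl : ∀ i, letters x y i ≠ 0) :
    (12 : ℚ) • Pit 5 (I41p (1 - x) y) =
      evalTerms (fun i => cls (letters x y i)) 5 reflectionTerms := by
  have hx : x ≠ 0 := hl 0
  have hx1 : 1 - x ≠ 0 := hl 1
  have hy : y ≠ 0 := hl 2
  have hD' : 1 - x - y ≠ 0 := hl 6
  have h7 : 1 - y + x * y ≠ 0 := hl 7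
  have hE : 1 - x - y⁻¹ = -((1 - y + x * y) / y) := by field_simp; ring
  have hE' : 1 - x - y⁻¹ ≠ 0 := by rw [hE]; exact neg_ne_zero.mpr (div_ne_zero h7 hy)
  apply Pit_I41p hl hx1 (by simpa using hx) (sub_ne_zero.mp hD') (sub_ne_zero.mp hE')
  · simp [letterSum_letters]
  · simp [letterSum_letters]
  · simp [letterSum_letters]
  · simp [letterSum_letters, hE, cls_neg, cls_div h7 hy, neg_add_eq_sub]

variable (F) in
/-- The span of the mod-products symbols of `Li₅` at nonconstant arguments. -/
def li5Span [CharZero F] : Submodule ℚ (TP F 5) :=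
  Submodule.span ℚ {s | ∃ g : F, g ∉ Set.range (algebraMap ℚ F) ∧ s = Pit 5 (SLi5 g)}

lemma mem_li5Span_of_cancels [CharZero F] (hl : ∀ i, letters x y i ≠ 0) {s : TP F 5}
    {ts : List (ℤ × List (Fin 8 → ℤ))} {table : List (LiTerm 8)}
    (hs : (12 : ℚ) • s = evalTerms (fun i => cls (letters x y i)) 5 ts)
    (ht : ∀ t ∈ table, t.arg (letters x y) ∉ Set.range (algebraMap ℚ F))
    (hsub : table ⊆ inversionTable ++ reflectionTable) (hc : cancels ts table = true) :
    s ∈ li5Span F := by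
  rw [← Submodule.smul_mem_iff _ (show (12 : ℚ) ≠ 0 by norm_num), hs,
    eq_sum_of_cancels hl (fun t h h0 => ht t h ⟨0, by simp [h0]⟩)
      (fun t h h1 => ht t h ⟨1, by simp [h1]⟩) (fun t h => one_sub_arg_letters hl t (hsub h)) hc]
  refine list_sum_mem fun u hu => ?_
  obtain ⟨t, h, rfl⟩ := List.mem_map.mp hu
  rw [← Int.cast_smul_eq_zsmul ℚ]
  exact Submodule.smul_mem _ _ (Submodule.subset_span ⟨_, ht t h, rfl⟩)

lemma inversion_mem_li5Span [CharZero F] (hl : ∀ i, letters x y i ≠ 0)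
    (ht : ∀ t ∈ inversionTable, t.arg (letters x y) ∉ Set.range (algebraMap ℚ F)) :
    Pit 5 (I41p x y) + Pit 5 (I41p x⁻¹ y) ∈ li5Span F := by
  refine mem_li5Span_of_cancels hl ?_ ht (List.subset_append_left _ _) inversion_cancels
  rw [smul_add, Pit_I41p_base hl, Pit_I41p_inv hl, evalTerms_append]

lemma reflection_mem_li5Span [CharZero F] (hl : ∀ i, letters x y i ≠ 0)
    (ht : ∀ t ∈ reflectionTable, t.arg (letters x y) ∉ Set.range (algebraMap ℚ F)) :
    Pit 5 (I41p x y) + Pit 5 (I41p (1 - x) y) ∈ li5Span F := by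
  refine mem_li5Span_of_cancels hl ?_ ht (List.subset_append_right _ _) reflection_cancels
  rw [smul_add, Pit_I41p_base hl, Pit_I41p_one_sub hl, evalTerms_append]

lemma sub_tI41p_mem_of_relations [CharZero F]
    (h₁ : Pit 5 (I41p x y) + Pit 5 (I41p x⁻¹ y) ∈ li5Span F)
    (h₂ : Pit 5 (I41p x y) + Pit 5 (I41p (1 - x) y) ∈ li5Span F)
    (h₃ : Pit 5 (I41p (1 - x) y) + Pit 5 (I41p (1 - x)⁻¹ y) ∈ li5Span F)
    (h₄ : Pit 5 (I41p x⁻¹ y) + Pit 5 (I41p (1 - x⁻¹) y) ∈ li5Span F)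
    (h₅ : Pit 5 (I41p (1 - x⁻¹) y) + Pit 5 (I41p (1 - x⁻¹)⁻¹ y) ∈ li5Span F)
    (hx : x ≠ 0) :
    Pit 5 (I41p x y) - Pit 5 (tI41p x y) ∈ li5Span F := by
  have hdiv : (1 - x⁻¹)⁻¹ = x / (x - 1) := by
    rw [← inv_div, sub_div, div_self hx, one_div]
  rw [hdiv] at h₅
  have key : Pit 5 (I41p x y) - Pit 5 (tI41p x y) = (6 : ℚ)⁻¹ •
      ((3 : ℚ) • (Pit 5 (I41p x y) + Pit 5 (I41p x⁻¹ y)) +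
        (2 : ℚ) • (Pit 5 (I41p x y) + Pit 5 (I41p (1 - x) y)) -
        (Pit 5 (I41p (1 - x) y) + Pit 5 (I41p (1 - x)⁻¹ y)) -
        (2 : ℚ) • (Pit 5 (I41p x⁻¹ y) + Pit 5 (I41p (1 - x⁻¹) y)) +
        (Pit 5 (I41p (1 - x⁻¹) y) + Pit 5 (I41p (x / (x - 1)) y))) := by
    simp only [tI41p, anhList, List.map_cons, List.map_nil, List.sum_cons, List.sum_nil, map_add,
      map_smul, map_zero]
    module
  rw [key]
  exact Submodule.smul_mem _ _ (add_mem (sub_mem (sub_mem (add_mem (Submodule.smul_mem _ _ h₁)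
    (Submodule.smul_mem _ _ h₂)) h₃) (Submodule.smul_mem _ _ h₄)) h₅)

end Relations

end TensorWords

section Evaluation

open MvPolynomial

/-- The rational function `g` is regular at the point `s` with value `c`. -/
def EvalsTo (s : Fin 2 → ℚ) (g : K2) (c : ℚ) : Prop :=
  ∃ p q : MvPolynomial (Fin 2) ℚ, eval s q ≠ 0 ∧
    g * algebraMap _ K2 q = algebraMap _ K2 p ∧ eval s p = c * eval s q

variable {s : Fin 2 → ℚ} {g h : K2} {c d : ℚ}

lemma evalsTo_algebraMap (p : MvPolynomial (Fin 2) ℚ) :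
    EvalsTo s (algebraMap _ K2 p) (eval s p) :=
  ⟨p, 1, by simp, by simp, by simp⟩

lemma evalsTo_const (c : ℚ) : EvalsTo s (algebraMap ℚ K2 c) c := by
  have h := evalsTo_algebraMap (s := s) (C c)
  rwa [eval_C, ← algebraMap_eq, ← IsScalarTower.algebraMap_apply] at h

lemma evalsTo_one : EvalsTo s 1 1 := by
  simpa using evalsTo_const (s := s) 1

lemma EvalsTo.add (hg : EvalsTo s g c) (hh : EvalsTo s h d) : EvalsTo s (g + h) (c + d) := by
  obtain ⟨p, q, hq, hpq, hc⟩ := hg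
  obtain ⟨p', q', hq', hpq', hc'⟩ := hh
  refine ⟨p * q' + p' * q, q * q', ?_, ?_, ?_⟩
  · simpa using ⟨hq, hq'⟩
  · simp only [map_add, map_mul, ← hpq, ← hpq']
    ring
  · simp only [map_add, map_mul, hc, hc']
    ring

lemma EvalsTo.mul (hg : EvalsTo s g c) (hh : EvalsTo s h d) : EvalsTo s (g * h) (c * d) := by
  obtain ⟨p, q, hq, hpq, hc⟩ := hg
  obtain ⟨p', q', hq', hpq', hc'⟩ := hh
  refine ⟨p * p', q * q', ?_, ?_, ?_⟩
  · simpa using ⟨hq, hq'⟩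
  · simp only [map_mul, ← hpq, ← hpq']
    ring
  · simp only [map_mul, hc, hc']
    ring

lemma EvalsTo.sub (hg : EvalsTo s g c) (hh : EvalsTo s h d) : EvalsTo s (g - h) (c - d) := by
  have := hg.add ((evalsTo_const (-1)).mul hh)
  simpa [sub_eq_add_neg] using this

lemma EvalsTo.eq_zero (hg : EvalsTo s 0 c) : c = 0 := by
  obtain ⟨p, q, hq, hpq, hc⟩ := hg
  have hp : p = 0 := by
    apply FaithfulSMul.algebraMap_injective (MvPolynomial (Fin 2) ℚ) K2
    rw [← hpq, zero_mul, map_zero]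
  rw [hp, map_zero] at hc
  exact (mul_eq_zero.mp hc.symm).resolve_right hq

lemma EvalsTo.ne_zero (hg : EvalsTo s g c) (hc : c ≠ 0) : g ≠ 0 := by
  rintro rfl
  exact hc hg.eq_zero

lemma EvalsTo.unique (hc : EvalsTo s g c) (hd : EvalsTo s g d) : c = d := by
  have h := hc.sub hd
  rw [sub_self] at h
  exact sub_eq_zero.mp h.eq_zero

lemma EvalsTo.inv (hg : EvalsTo s g c) (hc : c ≠ 0) : EvalsTo s g⁻¹ c⁻¹ := by
  have hg0 := hg.ne_zero hc
  obtain ⟨p, q, hq, hpq, h⟩ := hg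
  refine ⟨q, p, ?_, ?_, ?_⟩
  · rw [h]
    exact mul_ne_zero hc hq
  · rw [← hpq, inv_mul_cancel_left₀ hg0]
  · rw [h, inv_mul_cancel_left₀ hc]

lemma EvalsTo.zpow (hg : EvalsTo s g c) (hc : c ≠ 0) (n : ℤ) : EvalsTo s (g ^ n) (c ^ n) := by
  induction n using Int.induction_on with
  | zero => simpa using evalsTo_one
  | succ n ih =>
    rw [zpow_add_one₀ (hg.ne_zero hc), zpow_add_one₀ hc]
    exact ih.mul hg
  | pred n ih =>
    rw [zpow_sub_one₀ (hg.ne_zero hc), zpow_sub_one₀ hc]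
    exact ih.mul (hg.inv hc)

lemma EvalsTo.prod {ι : Type*} (t : Finset ι) {f : ι → K2} {v : ι → ℚ}
    (hf : ∀ i, EvalsTo s (f i) (v i)) : EvalsTo s (∏ i ∈ t, f i) (∏ i ∈ t, v i) := by
  induction t using Finset.induction_on with
  | empty => simpa using evalsTo_one
  | insert i t hi ih =>
    rw [Finset.prod_insert hi, Finset.prod_insert hi]
    exact (hf i).mul ih

lemma EvalsTo.arg {m : ℕ} (t : LiTerm m) {l : Fin m → K2} {v : Fin m → ℚ}
    (hl : ∀ i, EvalsTo s (l i) (v i)) (hv : ∀ i, v i ≠ 0) :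
    EvalsTo s (t.arg l) (t.arg v) := by
  refine EvalsTo.mul ?_ (EvalsTo.prod _ fun i => (hl i).zpow (hv i) _)
  simpa using evalsTo_const (s := s) ((t.sign : ℤ) : ℚ)

lemma EvalsTo.letters (hg : EvalsTo s g c) (hh : EvalsTo s h d) (i : Fin 8) :
    EvalsTo s (letters g h i) (letters c d i) := by
  fin_cases i
  · exact hg
  · exact evalsTo_one.sub hg
  · exact hh
  · exact evalsTo_one.sub hh
  · exact hg.sub hh
  · exact evalsTo_one.sub (hg.mul hh)
  · exact (evalsTo_one.sub hg).sub hh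
  · exact (evalsTo_one.sub hh).add (hg.mul hh)

/-- The letters do not vanish at two points, and these points separate the terms of a table from
the constants. -/
def Separates (table : List (LiTerm 8)) (c d c' d' : ℚ) : Prop :=
  (∀ i, GrassPoly.letters c d i ≠ 0) ∧ (∀ i, GrassPoly.letters c' d' i ≠ 0) ∧
    ∀ t ∈ table, t.arg (GrassPoly.letters c d) ≠ t.arg (GrassPoly.letters c' d')

lemma Separates.letters_ne_zero {table : List (LiTerm 8)} {c' d' : ℚ}
    (hsep : Separates table c d c' d') (hg : EvalsTo s g c) (hh : EvalsTo s h d) (i : Fin 8) :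
    GrassPoly.letters g h i ≠ 0 :=
  (hg.letters hh i).ne_zero (hsep.1 i)

lemma Separates.arg_notMem_range {table : List (LiTerm 8)} {s' : Fin 2 → ℚ} {c' d' : ℚ}
    (hsep : Separates table c d c' d') (hg : EvalsTo s g c) (hh : EvalsTo s h d)
    (hg' : EvalsTo s' g c') (hh' : EvalsTo s' h d') :
    ∀ t ∈ table, t.arg (GrassPoly.letters g h) ∉ Set.range (algebraMap ℚ K2) := by
  rintro t ht ⟨r, hr⟩
  have h₁ := EvalsTo.arg t (hg.letters hh) hsep.1
  have h₂ := EvalsTo.arg t (hg'.letters hh') hsep.2.1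
  rw [← hr] at h₁ h₂
  exact hsep.2.2 t ht ((h₁.unique (evalsTo_const r)).trans (h₂.unique (evalsTo_const r)).symm)

lemma evalsTo_xx : EvalsTo s xx (s 0) := by
  simpa [xx] using evalsTo_algebraMap (s := s) (X 0)

lemma evalsTo_yy : EvalsTo s yy (s 1) := by
  simpa [yy] using evalsTo_algebraMap (s := s) (X 1)

end Evaluation

theorem sub_tI41p_mem_li5Span : Pit 5 (I41p xx yy) - Pit 5 (tI41p xx yy) ∈ li5Span K2 := by
  have x₁ : EvalsTo ![3, 5] xx 3 := evalsTo_xx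
  have y₁ : EvalsTo ![3, 5] yy 5 := evalsTo_yy
  have x₂ : EvalsTo ![7, 11] xx 7 := evalsTo_xx
  have y₂ : EvalsTo ![7, 11] yy 11 := evalsTo_yy
  have hx := x₁.ne_zero (by norm_num)
  have i₁ := x₁.inv (by norm_num)
  have i₂ := x₂.inv (by norm_num)
  obtain ⟨s₁, s₂, s₃, s₄, s₅⟩ : Separates inversionTable 3 5 7 11 ∧
      Separates reflectionTable 3 5 7 11 ∧ Separates inversionTable (1 - 3) 5 (1 - 7) 11 ∧
      Separates reflectionTable 3⁻¹ 5 7⁻¹ 11 ∧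
      Separates inversionTable (1 - 3⁻¹) 5 (1 - 7⁻¹) 11 := by
    refine ⟨?_, ?_, ?_, ?_, ?_⟩ <;>
    · simp [Separates, Fin.forall_fin_succ, inversionTable, reflectionTable, letters, LiTerm.arg,
        Fin.prod_univ_succ]
      norm_num
  have r₁ := evalsTo_one.sub x₁
  have r₂ := evalsTo_one.sub x₂
  have t₁ := evalsTo_one.sub i₁
  have t₂ := evalsTo_one.sub i₂
  exact sub_tI41p_mem_of_relations
    (inversion_mem_li5Span (s₁.letters_ne_zero x₁ y₁) (s₁.arg_notMem_range x₁ y₁ x₂ y₂))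
    (reflection_mem_li5Span (s₂.letters_ne_zero x₁ y₁) (s₂.arg_notMem_range x₁ y₁ x₂ y₂))
    (inversion_mem_li5Span (s₃.letters_ne_zero r₁ y₁) (s₃.arg_notMem_range r₁ y₁ r₂ y₂))
    (reflection_mem_li5Span (s₄.letters_ne_zero i₁ y₁) (s₄.arg_notMem_range i₁ y₁ i₂ y₂))
    (inversion_mem_li5Span (s₅.letters_ne_zero t₁ y₁) (s₅.arg_notMem_range t₁ y₁ t₂ y₂))
    hx

end GrassPoly


/-- Proposition `i41tilde`, first part: `I⁺_{4,1}(x,y) - Ĩ⁺_{4,1}(x,y)` is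
(on the level of mod-products symbols) a ℚ-linear combination of `Li₅`'s of nonconstant
rational functions. -/
theorem i41p_minus_i41ptilde_is_li5 :
    ∃ (n : ℕ) (ν : Fin n → ℚ) (g : Fin n → K2),
      (∀ j, g j ∉ Set.range (algebraMap ℚ K2)) ∧
      Pit 5 (I41p xx yy) - Pit 5 (tI41p xx yy) = ∑ j, ν j • Pit 5 (SLi5 (g j)) := by
  obtain ⟨n, ν, s, h⟩ := Submodule.mem_span_set'.mp sub_tI41p_mem_li5Span
  choose g hg hs using fun j => (s j).2
  exact ⟨n, ν, g, hg, by simp only [← hs, h]⟩
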